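/- (Admissible spans have pushouts given by gluing.) Let (T, E_T), (I, E_I), (J, E_J) be Ising nets, and let s : T → I and t : T → J be injective functions that are morphisms of Ising nets and form an admissible span. Let I +_T J be the pushout of the underlying sets (the disjoint union of I and J with s(τ) identified with t(τ) for each τ ∈ T), with canonical injections ν_I : I → I +_T J and ν_J : J → I +_T J, and equip I +_T J with the energy E(u) = E_I(u ∘ ν_I) + E_J(u ∘ ν_J). Then: (a) ν_I and ν_J are morphisms of Ising nets; and (b) the square commutes and has the pushout universal property in the category of Ising nets: for every Ising net (X, E_X) and morphisms u : I → X, v : J → X with u ∘ s = v ∘ t, there is a unique function w : I +_T J → X with w ∘ ν_I = u and w ∘ ν_J = v, and this w is a morphism of Ising nets. -/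

import Mathlib

/-- A ground state of an Ising net `(I, E)` is a configuration at which the
energy function `E` attains its minimum. -/
def IsGround {ι : Type*} (E : (ι → Bool) → ℝ) (s : ι → Bool) : Prop :=
  ∀ t, E s ≤ E t

/-- A morphism of Ising nets from `(I, E_I)` to `(J, E_J)` is a function
`f : I → J` such that every ground state `x` of `(J, E_J)` restricts along `f`
to a ground state `x ∘ f` of `(I, E_I)`. -/
def IsIsingHom {ι κ : Type*} (Eι : (ι → Bool) → ℝ) (Eκ : (κ → Bool) → ℝ)
    (f : ι → κ) : Prop :=
  ∀ x : κ → Bool, IsGround Eκ x → IsGround Eι (x ∘ f)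

/-- Functions that agree along a span glue to a function on the pushout of sets. -/
theorem exists_glue_of_comp_eq {T I J P X : Type*} {s : T → I} {t : T → J}
    {νI : I → P} {νJ : J → P}
    (hνI_inj : Function.Injective νI) (hνJ_inj : Function.Injective νJ)
    (hν_surj : ∀ p, (∃ i, νI i = p) ∨ (∃ j, νJ j = p))
    (hν_glue : ∀ i j, νI i = νJ j → ∃ τ, s τ = i ∧ t τ = j)
    {u : I → X} {v : J → X} (huv : u ∘ s = v ∘ t) :
    ∃ w : P → X, w ∘ νI = u ∧ w ∘ νJ = v := by
  have agree : ∀ i j, νI i = νJ j → u i = v j := by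
    intro i j hij
    obtain ⟨τ, rfl, rfl⟩ := hν_glue i j hij
    exact congrFun huv τ
  have value : ∀ p, ∃ a, (∀ i, νI i = p → a = u i) ∧ ∀ j, νJ j = p → a = v j := by
    intro p
    rcases hν_surj p with ⟨i, rfl⟩ | ⟨j, rfl⟩
    · exact ⟨u i, fun i' h => by rw [hνI_inj h], fun j h => agree i j h.symm⟩
    · exact ⟨v j, fun i h => (agree i j h).symm, fun j' h => by rw [hνJ_inj h]⟩
  choose w hwI hwJ using value
  exact ⟨w, funext fun i => hwI _ i rfl, funext fun j => hwJ _ j rfl⟩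

/-- If the energies of the two legs have a common minimizer, the ground states of the summed
energy are the configurations restricting to ground states on both legs. -/
theorem isGround_iff_of_energy_eq_add {I J P : Type*} {EI : (I → Bool) → ℝ}
    {EJ : (J → Bool) → ℝ} {E : (P → Bool) → ℝ} {νI : I → P} {νJ : J → P}
    (hE : ∀ u, E u = EI (u ∘ νI) + EJ (u ∘ νJ)) {z : P → Bool}
    (hzI : IsGround EI (z ∘ νI)) (hzJ : IsGround EJ (z ∘ νJ)) (q : P → Bool) :
    IsGround E q ↔ IsGround EI (q ∘ νI) ∧ IsGround EJ (q ∘ νJ) := by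
  constructor
  · intro hq
    have hle := hq z
    rw [hE, hE] at hle
    have hI := hzI (q ∘ νI)
    have hJ := hzJ (q ∘ νJ)
    exact ⟨fun a => by linarith [hzI a], fun b => by linarith [hzJ b]⟩
  · rintro ⟨hI, hJ⟩ r
    rw [hE, hE]
    exact add_le_add (hI _) (hJ _)

/-- **Admissible spans have pushouts given by gluing.**
Let `(T, E_T)`, `(I, E_I)`, `(J, E_J)` be Ising nets and `s : T → I`,
`t : T → J` injective morphisms of Ising nets forming an admissible span
(there are ground states `x` of `(I, E_I)` and `y` of `(J, E_J)` with
`x ∘ s = y ∘ t`, this common configuration being a ground state of `(T, E_T)`).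
Let `P = I +_T J` be the pushout of the underlying sets — the disjoint union
of `I` and `J` with `s(τ)` identified with `t(τ)`, described by the canonical
injections `ν_I, ν_J` below — equipped with the energy
`E(u) = E_I(u ∘ ν_I) + E_J(u ∘ ν_J)`.  Then (a) `ν_I` and `ν_J` are morphisms
of Ising nets, and (b) the square has the pushout universal property in the
category of Ising nets: for every Ising net `(X, E_X)` and morphisms
`u : I → X`, `v : J → X` with `u ∘ s = v ∘ t`, there is a unique function
`w : P → X` with `w ∘ ν_I = u` and `w ∘ ν_J = v`, and this `w` is a morphism
of Ising nets. -/
theorem admissible_span_pushout {T I J P : Type*}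
    [Finite T] [Finite I] [Finite J] [Finite P]
    (ET : (T → Bool) → ℝ) (EI : (I → Bool) → ℝ) (EJ : (J → Bool) → ℝ)
    (s : T → I) (t : T → J)
    (hs_inj : Function.Injective s) (ht_inj : Function.Injective t)
    (hs_hom : IsIsingHom ET EI s) (ht_hom : IsIsingHom ET EJ t)
    (hadm : ∃ (x : I → Bool) (y : J → Bool),
      IsGround EI x ∧ IsGround EJ y ∧ x ∘ s = y ∘ t ∧ IsGround ET (x ∘ s))
    -- `P`, with `νI, νJ`, is the pushout of the underlying sets:
    (νI : I → P) (νJ : J → P)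
    (hν_comm : νI ∘ s = νJ ∘ t)
    (hνI_inj : Function.Injective νI) (hνJ_inj : Function.Injective νJ)
    (hν_surj : ∀ p, (∃ i, νI i = p) ∨ (∃ j, νJ j = p))
    (hν_glue : ∀ i j, νI i = νJ j ↔ ∃ τ, s τ = i ∧ t τ = j)
    (E : (P → Bool) → ℝ)
    (hE : ∀ u, E u = EI (u ∘ νI) + EJ (u ∘ νJ)) :
    IsIsingHom EI E νI ∧ IsIsingHom EJ E νJ ∧
      ∀ (X : Type*) (EX : (X → Bool) → ℝ) (u : I → X) (v : J → X),
        IsIsingHom EI EX u → IsIsingHom EJ EX v → u ∘ s = v ∘ t →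
        ∃ w : P → X, (w ∘ νI = u ∧ w ∘ νJ = v) ∧ IsIsingHom E EX w ∧
          ∀ w' : P → X, w' ∘ νI = u ∧ w' ∘ νJ = v → w' = w := by
  obtain ⟨x, y, hx, hy, hxy, -⟩ := hadm
  obtain ⟨z, rfl, rfl⟩ :=
    exists_glue_of_comp_eq hνI_inj hνJ_inj hν_surj (fun i j => (hν_glue i j).1) hxy
  have ground_iff := isGround_iff_of_energy_eq_add hE hx hy
  refine ⟨fun q hq => ((ground_iff q).1 hq).1, fun q hq => ((ground_iff q).1 hq).2, ?_⟩
  intro X EX u v hu hv huv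
  obtain ⟨w, rfl, rfl⟩ :=
    exists_glue_of_comp_eq hνI_inj hνJ_inj hν_surj (fun i j => (hν_glue i j).1) huv
  refine ⟨w, ⟨rfl, rfl⟩, fun q hq => (ground_iff _).2 ⟨hu q hq, hv q hq⟩, ?_⟩
  rintro w' ⟨hI, hJ⟩
  funext p
  rcases hν_surj p with ⟨i, rfl⟩ | ⟨j, rfl⟩
  · exact congrFun hI i
  · exact congrFun hJ j
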